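/- arXiv:1409.1597 — 2 statements merged into one kernel-verified Lean document; each statement's English description precedes it below -/
import Mathlib

section
/- Let G be an infinite group. A subset A of G is sparse if and only if ϑ_p(A) is finite for every p ∈ G*. -/
open Pointwise

/-- `gp`: the image of `p` under the left shift `x ↦ g * x`. -/
def SmulUf {G : Type*} [Group G] (g : G) (p : Ultrafilter G) : Ultrafilter G :=
  p.map (fun x => g * x)

/-- `p` is a free (non-principal) ultrafilter. -/
def FreeUf {G : Type*} (p : Ultrafilter G) : Prop := ∀ g : G, p ≠ pure g

/-- The `p`-companion `ϑ_p(A) = {gp : g ∈ G, A ∈ gp}`. -/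
def Theta {G : Type*} [Group G] (A : Set G) (p : Ultrafilter G) : Set (Ultrafilter G) :=
  {q | ∃ g : G, q = SmulUf g p ∧ A ∈ q}

/-- `A` is sparse: every infinite `S ⊆ G` contains a nonempty finite `F ⊆ S`
such that `⋂_{g ∈ F} gA` is finite. -/
def Sparse {G : Type*} [Group G] (A : Set G) : Prop :=
  ∀ S : Set G, S.Infinite → ∃ F : Set G, F ⊆ S ∧ F.Finite ∧ F.Nonempty ∧
    (⋂ g ∈ F, (fun x => g * x) '' A).Finite

theorem aux_cover {G : Type*} [Group G] (x : G) (hx : x ≠ 1) :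
    ∃ B : Set G, (∀ b ∈ B, x * b ∉ B) ∧ ∀ g, g ∈ B ∨ x⁻¹ * g ∈ B ∨ x * g ∈ B := by
  obtain ⟨B, hB⟩ := zorn_subset {B : Set G | ∀ b ∈ B, x * b ∉ B} (by
    intro c hc hch
    refine ⟨⋃₀ c, ?_, fun s hs => Set.subset_sUnion_of_mem hs⟩
    rintro b ⟨s, hs, hb⟩ ⟨t, ht, hb'⟩
    rcases hch.total hs ht with h | h
    · exact hc ht b (h hb) hb'
    · exact hc hs b hb (h hb'))
  refine ⟨B, hB.prop, fun g => ?_⟩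
  by_contra! hcon
  obtain ⟨h1, h2, h3⟩ := hcon
  have hP : insert g B ∈ {B : Set G | ∀ b ∈ B, x * b ∉ B} := by
    rintro b (rfl | hb) (h | h)
    · exact hx (by simpa using h)
    · exact h3 h
    · apply h2
      rw [← h]
      simpa using hb
    · exact hB.prop b hb h
  exact h1 (hB.le_of_ge hP (Set.subset_insert g B) (Set.mem_insert g B))

theorem aux_fix {G : Type*} [Group G] (x : G) (p : Ultrafilter G) (h : SmulUf x p = p) :
    x = 1 := by
  by_contra hx
  obtain ⟨B, hB, hc⟩ := aux_cover x hx
  have key : ∀ C : Set G, C ∈ p → (fun y => x * y) ⁻¹' C ∈ p := by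
    intro C hC
    rw [← h] at hC
    exact hC
  have hno : ∀ C : Set G, (∀ b ∈ C, x * b ∉ C) → C ∉ p := by
    intro C hC hp
    have h0 := Filter.inter_mem hp (key C hp)
    obtain ⟨b, hb, hb'⟩ := p.nonempty_of_mem h0
    exact hC b hb hb'
  have hu : B ∪ ({g | x⁻¹ * g ∈ B} ∪ {g | x * g ∈ B}) ∈ p :=
    Filter.mem_of_superset Filter.univ_mem (fun g _ => hc g)
  rcases Ultrafilter.union_mem_iff.1 hu with h1 | h1
  · exact hno _ hB h1
  rcases Ultrafilter.union_mem_iff.1 h1 with h1 | h1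
  · refine hno {g | x⁻¹ * g ∈ B} (fun b hb hb2 => hB _ hb ?_) h1
    simpa using hb2
  · exact hno {g | x * g ∈ B} (fun b hb hb' => hB _ hb hb') h1

theorem aux_inj {G : Type*} [Group G] (p : Ultrafilter G) :
    Function.Injective (fun g : G => SmulUf g p) := by
  intro g h hgh
  have : SmulUf (h⁻¹ * g) p = p := by
    have h2 := congrArg (SmulUf h⁻¹) hgh
    simp only [SmulUf, Ultrafilter.map_map] at h2 ⊢
    have e1 : (fun x => h⁻¹ * x) ∘ (fun x => g * x) = fun x => h⁻¹ * g * x := by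
      funext x; simp [mul_assoc]
    have e2 : (fun x => h⁻¹ * x) ∘ (fun x => h * x) = id := by
      funext x; simp
    rw [e1, e2, Ultrafilter.map_id] at h2
    exact h2
  have := aux_fix _ _ this
  exact (inv_mul_eq_one.1 this).symm

theorem aux_mem {G : Type*} [Group G] (A : Set G) (p : Ultrafilter G) (g : G) :
    A ∈ SmulUf g⁻¹ p ↔ (fun x => g * x) '' A ∈ p := by
  have : (fun x => g * x) '' A = (fun x => g⁻¹ * x) ⁻¹' A := by
    ext y; simp
  rw [this]; rfl

theorem aux_free {G : Type*} (p : Ultrafilter G) :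
    FreeUf p ↔ ∀ s : Set G, s.Finite → s ∉ p := by
  constructor
  · intro h s hs hp
    obtain ⟨x, _, hx⟩ := Ultrafilter.eq_pure_of_finite_mem hs hp
    exact h x hx
  · rintro h g rfl
    exact h {g} (Set.finite_singleton g) (Ultrafilter.mem_pure.2 rfl)

theorem sparse_iff_ultracompanions_finite {G : Type*} [Group G] [Infinite G]
    (A : Set G) :
    Sparse A ↔ ∀ p : Ultrafilter G, FreeUf p → (Theta A p).Finite := by
  constructor
  · intro hS p hp
    by_contra hinf
    have hSi : {g : G | (fun x => g * x) '' A ∈ p}.Infinite := by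
      intro hf
      apply hinf
      refine (hf.image (fun g => SmulUf g⁻¹ p)).subset ?_
      rintro q ⟨g, rfl, hA⟩
      refine ⟨g⁻¹, ?_, by simp⟩
      show _ ∈ p
      rw [← aux_mem]
      simpa using hA
    obtain ⟨F, hF, hfin, -, hi⟩ := hS _ hSi
    exact (aux_free p).1 hp _ hi ((Filter.biInter_mem hfin).2 fun g hg => hF hg)
  · intro h S hS
    by_contra! hcon
    let f : Filter G := Filter.cofinite ⊓ ⨅ g ∈ S, Filter.principal ((fun x => g * x) '' A)
    have hne : f.NeBot := by
      rw [Filter.inf_neBot_iff]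
      intro s hs t ht
      rw [Filter.mem_biInf_principal] at ht
      obtain ⟨F, hF, hFS, hFt⟩ := ht
      obtain ⟨g0, hg0⟩ := hS.nonempty
      have := hcon (insert g0 F) (Set.insert_subset hg0 hFS) (hF.insert _) (Set.insert_nonempty _ _)
      obtain ⟨y, hy, hys⟩ := Set.Infinite.exists_notMem_finite this (Filter.mem_cofinite.1 hs)
      refine ⟨y, by simpa using hys, hFt ?_⟩
      simp only [Set.mem_iInter] at hy ⊢
      exact fun i hi => hy i (Set.mem_insert_of_mem _ hi)
    obtain ⟨p, hp⟩ := Ultrafilter.exists_le f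
    have hfree : FreeUf p := by
      rw [aux_free]
      intro s hs hsp
      have : sᶜ ∈ p := (hp.trans inf_le_left) hs.compl_mem_cofinite
      exact Ultrafilter.compl_mem_iff_notMem.1 this hsp
    have hm : ∀ g ∈ S, (fun x => g * x) '' A ∈ p := fun g hg =>
      (hp.trans (inf_le_right.trans (iInf₂_le g hg))) (Filter.mem_principal_self _)
    have hinj : Function.Injective (fun g : G => SmulUf g⁻¹ p) := fun a b hab =>
      inv_injective (aux_inj p hab)
    refine (hS.image hinj.injOn) ((h p hfree).subset ?_)
    rintro _ ⟨g, hg, rfl⟩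
    exact ⟨g⁻¹, rfl, (aux_mem A p g).2 (hm g hg)⟩
end

section
/- Let G be an infinite group and A a subset of G. The following are equivalent: (ii) for every infinite subset Y of A there exists a free ultrafilter p on G with Y ∈ p such that ϑ_p(Y) is finite; (iv) A contains no piecewise shifted FP-set. -/
open Pointwise

/-- The piecewise shifted FP-set determined by the sequences `g` and `b`:
`{g_{i₁} g_{i₂} ⋯ g_{i_n} · b_{i_n} : n ≥ 1, i₁ < i₂ < ⋯ < i_n}`. -/
def PiecewiseShiftedFP {G : Type*} [Group G] (g b : ℕ → G) : Set G :=
  {x | ∃ s : Finset ℕ, ∃ hs : s.Nonempty,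
    x = ((s.sort (· ≤ ·)).map g).prod * b (s.max' hs)}


theorem mem_smulUf {G : Type*} [Group G] (g : G) (p : Ultrafilter G) (Z : Set G) :
    Z ∈ SmulUf g p ↔ {x | g * x ∈ Z} ∈ p := Iff.rfl

theorem smulUf_mul {G : Type*} [Group G] (g h : G) (p : Ultrafilter G) :
    SmulUf g (SmulUf h p) = SmulUf (g * h) p := by
  ext Z
  simp only [mem_smulUf, Set.mem_ofPred_eq, mul_assoc]

theorem smulUf_one {G : Type*} [Group G] (p : Ultrafilter G) :
    SmulUf 1 p = p := by
  ext Z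
  simp only [mem_smulUf, one_mul, Set.ofPred_mem_eq]

theorem freeUf_iff {G : Type*} (p : Ultrafilter G) : FreeUf p ↔ ∀ g : G, {g} ∉ p := by
  refine forall_congr' fun g => not_congr ⟨?_, ?_⟩
  · rintro rfl
    exact Ultrafilter.mem_pure.2 rfl
  · intro h
    have : (p : Filter G) ≤ pure g := by
      rw [Filter.le_pure_iff]; exact h
    exact Ultrafilter.coe_le_coe.1 this

theorem freeUf_smul {G : Type*} [Group G] (g : G) (p : Ultrafilter G) (hp : FreeUf p) :
    FreeUf (SmulUf g p) := by
  rw [freeUf_iff] at *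
  intro x hx
  apply hp (g⁻¹ * x)
  rw [mem_smulUf] at hx
  convert hx using 1
  ext y
  simp [eq_inv_mul_iff_mul_eq]

theorem smulUf_fixed {G : Type*} [Group G] (g : G) (p : Ultrafilter G)
    (h : SmulUf g p = p) : g = 1 := by
  by_contra hg
  obtain ⟨M, hM⟩ : ∃ M : Set G, Maximal (fun M : Set G => ∀ x ∈ M, g * x ∉ M) M := by
    apply zorn_subset
    intro c hc hch
    refine ⟨⋃₀ c, ?_, fun s hs => Set.subset_sUnion_of_mem hs⟩
    rintro x ⟨s, hs, hx⟩ ⟨t, ht, hy⟩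
    rcases hch.total hs ht with h1 | h1
    · exact hc ht x (h1 hx) hy
    · exact hc hs x hx (h1 hy)
  have key : ∀ x, x ∈ M ∨ g * x ∈ M ∨ g⁻¹ * x ∈ M := by
    intro x
    by_contra! hx
    obtain ⟨h1, h2, h3⟩ := hx
    apply h1
    refine hM.2 (y := insert x M) ?_ (Set.subset_insert _ _) (Set.mem_insert _ _)
    rintro y (rfl | hy) (h4 | h4)
    · exact hg (by simpa using h4)
    · exact h2 h4
    · apply h3; rw [← h4]; simpa using hy
    · exact hM.1 y hy h4
  have iff1 : ∀ Z : Set G, {x | g * x ∈ Z} ∈ p ↔ Z ∈ p := by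
    intro Z
    rw [← mem_smulUf, h]
  have hMp : M ∈ p := by
    by_contra hn
    have h2 : {x | g * x ∈ M} ∉ p := by rwa [iff1]
    have h3 : {x | g⁻¹ * x ∈ M} ∉ p := by
      rw [← iff1]; simpa using hn
    have h1' := Ultrafilter.compl_mem_iff_notMem.2 hn
    have h2' := Ultrafilter.compl_mem_iff_notMem.2 h2
    have h3' := Ultrafilter.compl_mem_iff_notMem.2 h3
    obtain ⟨x, hx⟩ := p.nonempty_of_mem (Filter.inter_mem h1' (Filter.inter_mem h2' h3'))
    rcases key x with h | h | h
    · exact hx.1 h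
    · exact hx.2.1 h
    · exact hx.2.2 h
  obtain ⟨x, hx⟩ := p.nonempty_of_mem (Filter.inter_mem hMp ((iff1 M).2 hMp))
  exact hM.1 x hx.1 hx.2

theorem smulUf_inj {G : Type*} [Group G] (p : Ultrafilter G) :
    Function.Injective (fun g => SmulUf g p) := by
  intro g h hgh
  have : SmulUf (h⁻¹ * g) p = p := by
    rw [← smulUf_mul]
    simp only at hgh
    rw [hgh, smulUf_mul]; simp [smulUf_one]
  have := smulUf_fixed _ _ this
  exact (inv_mul_eq_one.1 this).symm

def TailFP {G : Type*} [Group G] (g b : ℕ → G) (N : ℕ) : Set G :=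
  {x | ∃ s : Finset ℕ, ∃ hs : s.Nonempty, (∀ i ∈ s, N ≤ i) ∧
    x = ((s.sort (· ≤ ·)).map g).prod * b (s.max' hs)}

theorem elt_insert {G : Type*} [Group G] (g b : ℕ → G) (i : ℕ) (s : Finset ℕ)
    (hs : s.Nonempty) (h : ∀ j ∈ s, i < j) :
    (((insert i s).sort (· ≤ ·)).map g).prod * b ((insert i s).max' (Finset.insert_nonempty i s))
      = g i * (((s.sort (· ≤ ·)).map g).prod * b (s.max' hs)) := by
  have h1 : i ∉ s := fun hi => lt_irrefl _ (h i hi)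
  rw [Finset.sort_insert (· ≤ ·) (fun j hj => (h j hj).le) h1, Finset.max'_insert i s hs,
    max_eq_right (h _ (s.max'_mem hs)).le]
  simp [mul_assoc]

theorem tail_step {G : Type*} [Group G] (g b : ℕ → G) (N : ℕ) (x : G)
    (hx : x ∈ TailFP g b N) :
    x ∈ TailFP g b (N + 1) ∨ (g N)⁻¹ * x ∈ TailFP g b (N + 1) ∨ x = g N * b N := by
  obtain ⟨s, hs, hN, rfl⟩ := hx
  by_cases hm : N ∈ s
  · right
    obtain ⟨t, hNt, rfl⟩ : ∃ t, N ∉ t ∧ s = insert N t :=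
      ⟨s.erase N, by simp, (Finset.insert_erase hm).symm⟩
    have ht' : ∀ j ∈ t, N < j := fun j hj =>
      lt_of_le_of_ne (hN j (Finset.mem_insert_of_mem hj)) (fun h => hNt (h ▸ hj))
    rcases t.eq_empty_or_nonempty with rfl | ht
    · right; simp
    · left
      refine ⟨t, ht, fun j hj => ht' j hj, ?_⟩
      rw [elt_insert g b N t ht ht']; simp
  · left
    refine ⟨s, hs, fun j hj => ?_, rfl⟩
    exact lt_of_le_of_ne (hN j hj) (fun h => hm (h ▸ hj))

theorem tail_mul {G : Type*} [Group G] (g b : ℕ → G) (N i : ℕ) (hi : i < N) (x : G)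
    (hx : x ∈ TailFP g b N) : g i * x ∈ PiecewiseShiftedFP g b := by
  obtain ⟨s, hs, hN, rfl⟩ := hx
  refine ⟨insert i s, Finset.insert_nonempty _ _, ?_⟩
  rw [elt_insert g b i s hs (fun j hj => hi.trans_le (hN j hj))]

theorem psfp_infinite {G : Type*} [Group G] (g b : ℕ → G) (hg : Function.Injective g) :
    (PiecewiseShiftedFP g b).Infinite := by
  classical
  intro hfin
  set n := hfin.toFinset.card + 1 with hn
  have hx : g n * b n ∈ TailFP g b n := ⟨{n}, by simp, by simp, by simp⟩
  have hsub : (Finset.range n).image (fun i => g i * (g n * b n)) ⊆ hfin.toFinset := by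
    intro y hy
    simp only [Finset.mem_image, Finset.mem_range] at hy
    obtain ⟨i, hi, rfl⟩ := hy
    simpa using tail_mul g b n i hi _ hx
  have := Finset.card_le_card hsub
  rw [Finset.card_image_of_injective _ (fun i j h => hg (mul_right_cancel h))] at this
  simp at this
  omega

theorem theta_infinite {G : Type*} [Group G] (g b : ℕ → G) (hg : Function.Injective g)
    (p : Ultrafilter G) (hp : FreeUf p) (hY : PiecewiseShiftedFP g b ∈ p) :
    (Theta (PiecewiseShiftedFP g b) p).Infinite := by
  have key : ∀ N, ∃ h : G, TailFP g b N ∈ SmulUf h p := by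
    intro N
    induction N with
    | zero =>
      refine ⟨1, ?_⟩
      rw [smulUf_one]
      convert hY using 1
      ext x
      simp [TailFP, PiecewiseShiftedFP]
    | succ N ih =>
      obtain ⟨h, hh⟩ := ih
      by_contra! hcon
      have h1 := Ultrafilter.compl_mem_iff_notMem.2 (hcon h)
      have h2 := hcon ((g N)⁻¹ * h)
      rw [← smulUf_mul, mem_smulUf] at h2
      have h2 := Ultrafilter.compl_mem_iff_notMem.2 h2
      have h3 := Ultrafilter.compl_mem_iff_notMem.2
        ((freeUf_iff _).1 (freeUf_smul h p hp) (g N * b N))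
      obtain ⟨x, hx⟩ := (SmulUf h p).nonempty_of_mem
        (Filter.inter_mem hh (Filter.inter_mem h1 (Filter.inter_mem h2 h3)))
      rcases tail_step g b N x hx.1 with h | h | h
      · exact hx.2.1 h
      · exact hx.2.2.1 h
      · exact hx.2.2.2 h
  intro hfin
  set n := hfin.toFinset.card + 1 with hn
  obtain ⟨h, hh⟩ := key n
  classical
  have hsub : (Finset.range n).image (fun i => SmulUf (g i * h) p) ⊆ hfin.toFinset := by
    intro y hy
    simp only [Finset.mem_image, Finset.mem_range] at hy
    obtain ⟨i, hi, rfl⟩ := hy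
    rw [Set.Finite.mem_toFinset]
    refine ⟨g i * h, rfl, ?_⟩
    rw [← smulUf_mul, mem_smulUf]
    exact Filter.mem_of_superset hh (fun x hx => tail_mul g b n i hi x hx)
  have := Finset.card_le_card hsub
  rw [Finset.card_image_of_injective _
    (fun i j h => hg (mul_right_cancel (smulUf_inj p h)))] at this
  simp at this
  omega

theorem exists_free {α : Type*} (S : Set α) (hS : S.Infinite) :
    ∃ r : Ultrafilter α, S ∈ r ∧ ∀ T ∈ r, T.Infinite := by
  haveI : (Filter.cofinite ⊓ Filter.principal S).NeBot := hS.cofinite_inf_principal_neBot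
  refine ⟨Ultrafilter.of (Filter.cofinite ⊓ Filter.principal S), ?_, ?_⟩
  · exact (Ultrafilter.of_le _).trans inf_le_right (Filter.mem_principal_self S)
  · intro T hT hfin
    have : Tᶜ ∈ Ultrafilter.of (Filter.cofinite ⊓ Filter.principal S) :=
      (Ultrafilter.of_le _).trans inf_le_left hfin.compl_mem_cofinite
    exact Ultrafilter.compl_mem_iff_notMem.1 this hT

theorem not_mem_closed {G : Type*} {K : Set (Ultrafilter G)} (hK : IsClosed K)
    {q : Ultrafilter G} (hq : q ∉ K) : ∃ Z ∈ q, ∀ r ∈ K, Z ∉ r := by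
  obtain ⟨V, ⟨Z, rfl⟩, h1, h2⟩ := ultrafilterBasis_is_basis.exists_subset_of_mem_open
    (show q ∈ Kᶜ from hq) hK.isOpen_compl
  exact ⟨Z, h1, fun r hr hZ => h2 hZ hr⟩

theorem closed_of {G : Type*} {K : Set (Ultrafilter G)}
    (h : ∀ q, q ∉ K → ∃ Z ∈ q, ∀ r ∈ K, Z ∉ r) : IsClosed K := by
  rw [← isOpen_compl_iff, isOpen_iff_forall_mem_open]
  intro q hq
  obtain ⟨Z, h1, h2⟩ := h q hq
  exact ⟨{r | Z ∈ r}, fun r hr hrK => h2 r hrK hr, ultrafilter_isOpen_basic Z, h1⟩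

theorem exists_recurrent {G : Type*} [Group G] (Y : Set G) (hY : Y.Infinite)
    (H : ∀ p : Ultrafilter G, FreeUf p → Y ∈ p → (Theta Y p).Infinite) :
    ∃ p : Ultrafilter G, Y ∈ p ∧ ∀ Z ∈ p, {g : G | Z ∈ SmulUf g p}.Infinite := by
  let S : Set (Set (Ultrafilter G)) := {K | IsClosed K ∧ (∀ g, ∀ q ∈ K, SmulUf g q ∈ K) ∧
    (∀ q ∈ K, FreeUf q) ∧ ∃ q ∈ K, Y ∈ q}
  have hK0 : {q : Ultrafilter G | FreeUf q} ∈ S := by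
    refine ⟨closed_of ?_, fun g q hq => freeUf_smul g q hq, fun q hq => hq, ?_⟩
    · intro q hq
      simp only [Set.mem_ofPred_eq, freeUf_iff, not_forall, not_not] at hq
      obtain ⟨x, hx⟩ := hq
      exact ⟨{x}, hx, fun r hr => (freeUf_iff r).1 hr x⟩
    · obtain ⟨r, hr, hr'⟩ := exists_free Y hY
      exact ⟨r, (freeUf_iff r).2 fun x hx => hr' _ hx (Set.finite_singleton x), hr⟩
  obtain ⟨K, -, hKm⟩ := zorn_superset_nonempty S (by
    intro c hcS hch hne
    refine ⟨⋂₀ c, ⟨isClosed_sInter fun K hK => (hcS hK).1, ?_, ?_, ?_⟩,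
      fun s hs => Set.sInter_subset_of_mem hs⟩
    · intro g q hq K hK
      exact (hcS hK).2.1 g q (hq K hK)
    · obtain ⟨K, hK⟩ := hne
      intro q hq
      exact (hcS hK).2.2.1 q (hq K hK)
    · haveI : Nonempty c := hne.to_subtype
      have hcl : ∀ K : c, IsClosed ((K : Set (Ultrafilter G)) ∩ {q | Y ∈ q}) := fun K =>
        (hcS K.2).1.inter (ultrafilter_isClosed_basic Y)
      obtain ⟨q, hq⟩ := IsCompact.nonempty_iInter_of_directed_nonempty_isCompact_isClosed
        (fun K : c => (K : Set (Ultrafilter G)) ∩ {q | Y ∈ q}) (by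
          intro K L
          rcases hch.total K.2 L.2 with h | h
          · exact ⟨K, subset_rfl, Set.inter_subset_inter_left _ h⟩
          · exact ⟨L, Set.inter_subset_inter_left _ h, subset_rfl⟩)
        (fun K => by obtain ⟨q, h1, h2⟩ := (hcS K.2).2.2.2; exact ⟨q, h1, h2⟩)
        (fun K => (hcl K).isCompact) hcl
      rw [Set.mem_iInter] at hq
      exact ⟨q, fun K hK => (hq ⟨K, hK⟩).1, (hq (Classical.arbitrary c)).2⟩) _ hK0
  obtain ⟨hKc, hKi, hKf, p, hpK, hpY⟩ := hKm.1
  refine ⟨p, hpY, ?_⟩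
  let L : Set (Ultrafilter G) := {q | ∀ Z ∈ q, {g : G | Z ∈ SmulUf g p}.Infinite}
  have hLK : L ⊆ K := by
    intro q hq
    by_contra hqK
    obtain ⟨Z, hZ, hZ'⟩ := not_mem_closed hKc hqK
    obtain ⟨g, hg⟩ := (hq Z hZ).nonempty
    exact hZ' _ (hKi g p hpK) hg
  have hLS : L ∈ S := by
    refine ⟨closed_of ?_, ?_, fun q hq => hKf q (hLK hq), ?_⟩
    · intro q hq
      simp only [L, Set.mem_ofPred_eq, not_forall] at hq
      obtain ⟨Z, hZ, hZ'⟩ := hq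
      exact ⟨Z, hZ, fun r hr hZr => hZ' (hr Z hZr)⟩
    · intro h q hq Z hZ
      rw [mem_smulUf] at hZ
      have := (hq _ hZ).image (f := fun g => h * g) (mul_right_injective h).injOn
      refine this.mono ?_
      rintro _ ⟨g, hg, rfl⟩
      simp only [Set.mem_ofPred_eq] at hg ⊢
      rw [← smulUf_mul]
      exact hg
    · have hinf : {g : G | Y ∈ SmulUf g p}.Infinite := by
        intro hfin
        apply H p (hKf p hpK) hpY
        refine (hfin.image (fun g => SmulUf g p)).subset ?_
        rintro q ⟨g, rfl, hg⟩
        exact ⟨g, hg, rfl⟩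
      obtain ⟨r, hr, hr'⟩ := exists_free _ hinf
      exact ⟨r.bind (fun g => SmulUf g p), fun Z hZ => hr' _ hZ, hr⟩
  exact hKm.2 hLS hLK hpK

theorem psfp_of_recurrent {G : Type*} [Group G] (Y : Set G) (p : Ultrafilter G)
    (hY : Y ∈ p) (hp : ∀ Z ∈ p, {g : G | Z ∈ SmulUf g p}.Infinite) :
    ∃ g b : ℕ → G, Function.Injective g ∧ PiecewiseShiftedFP g b ⊆ Y := by
  classical
  have hpick : ∀ (Z : {Z : Set G // Z ∈ p}) (F : Finset G), ∃ g : G,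
      Z.1 ∈ SmulUf g p ∧ g ∉ F := by
    intro Z F
    obtain ⟨g, h1, h2⟩ := (hp Z.1 Z.2).exists_notMem_finset F
    exact ⟨g, h1, h2⟩
  choose pick hpk1 hpk2 using hpick
  let st : ℕ → {Z : Set G // Z ∈ p} × Finset G := fun n => Nat.rec (⟨Y, hY⟩, ∅)
    (fun _ s => (⟨s.1.1 ∩ {x | pick s.1 s.2 * x ∈ s.1.1},
      Filter.inter_mem s.1.2 (hpk1 s.1 s.2)⟩, insert (pick s.1 s.2) s.2)) n
  let g : ℕ → G := fun n => pick (st n).1 (st n).2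
  let Z : ℕ → Set G := fun n => (st n).1.1
  have hZs : ∀ n, Z (n + 1) = Z n ∩ {x | g n * x ∈ Z n} := fun n => rfl
  have hFs : ∀ n, (st (n + 1)).2 = insert (g n) (st n).2 := fun n => rfl
  have hanti : Antitone Z := antitone_nat_of_succ_le fun n => by
    rw [hZs]; exact Set.inter_subset_left
  have hF : ∀ m n, m < n → g m ∈ (st n).2 := by
    intro m n hmn
    induction n with
    | zero => omega
    | succ n ih =>
      rw [hFs]
      rcases Nat.lt_succ_iff_lt_or_eq.1 hmn with h | rfl
      · exact Finset.mem_insert_of_mem (ih h)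
      · exact Finset.mem_insert_self _ _
  have hne : ∀ m n, m < n → g m ≠ g n := fun m n hmn h =>
    hpk2 (st n).1 (st n).2 (by have := hF m n hmn; rwa [h] at this)
  have hb : ∀ n, ∃ x, x ∈ Z (n + 1) := fun n => p.nonempty_of_mem (st (n + 1)).1.2
  choose b hb using hb
  have key : ∀ (l : List ℕ) (m n : ℕ) (x : G), l.Pairwise (· < ·) → m ≤ n →
      (∀ a ∈ l, m ≤ a ∧ a < n) → x ∈ Z n → (l.map g).prod * x ∈ Z m := by
    intro l
    induction l with
    | nil =>
      intro m n x _ hmn _ hx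
      simpa using hanti hmn hx
    | cons a l ih =>
      intro m n x hl hmn hall hx
      rw [List.pairwise_cons] at hl
      obtain ⟨ha1, ha2⟩ := hall a (by simp)
      have := ih (a + 1) n x hl.2 ha2
        (fun c hc => ⟨hl.1 c hc, (hall c (by simp [hc])).2⟩) hx
      rw [hZs] at this
      have := hanti ha1 this.2
      simpa [mul_assoc] using this
  refine ⟨g, b, ?_, ?_⟩
  · intro m n h
    rcases lt_trichotomy m n with h1 | h1 | h1
    · exact absurd h (hne _ _ h1)
    · exact h1
    · exact absurd h.symm (hne _ _ h1)
  · rintro x ⟨s, hs, rfl⟩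
    refine key _ 0 (s.max' hs + 1) _ (Finset.sortedLT_sort s).pairwise (Nat.zero_le _) ?_ (hb _)
    intro a ha
    exact ⟨Nat.zero_le _, Nat.lt_succ_of_le (s.le_max' a (by simpa using ha))⟩

theorem scattered_iff_no_piecewise_shifted_fp {G : Type*} [Group G] [Infinite G]
    (A : Set G) :
    (∀ Y : Set G, Y ⊆ A → Y.Infinite →
        ∃ p : Ultrafilter G, FreeUf p ∧ Y ∈ p ∧ (Theta Y p).Finite) ↔
    ¬ ∃ g b : ℕ → G, Function.Injective g ∧ PiecewiseShiftedFP g b ⊆ A := by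
  constructor
  · rintro h ⟨g, b, hg, hA⟩
    obtain ⟨p, hp, hY, hfin⟩ := h _ hA (psfp_infinite g b hg)
    exact theta_infinite g b hg p hp hY hfin
  · intro h Y hYA hY
    by_contra hcon
    obtain ⟨p, hYp, hp⟩ := exists_recurrent Y hY
      (fun p h1 h2 h3 => hcon ⟨p, h1, h2, h3⟩)
    obtain ⟨g, b, hg, hb⟩ := psfp_of_recurrent Y p hYp hp
    exact h ⟨g, b, hg, hb.trans hYA⟩
end
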